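/- Let n, k, j be positive integers with 1 ≤ k and k + j < n, let ε ≥ 0, and let A be an n×n real symmetric matrix satisfying |λ_{k+j}(A) − λ_k(A)| ≤ ε n^{-1/2}. Let i_1, …, i_j ∈ [n] be distinct. Then there exist unit vectors w^{(0)}, w^{(1)}, …, w^{(j)}, where w^{(0)} is a unit eigenvector of A with eigenvalue λ_k(A) and, for each r ∈ [j], w^{(r)} is a unit eigenvector of the minor A^{(i_1,…,i_r)} with eigenvalue λ_k(A^{(i_1,…,i_r)}), such that for every r ∈ [j]: |w^{(r-1)}_{i_r}| · |⟨w^{(r)}, X_r⟩| ≤ ε n^{-1/2}, where X_r ∈ ℝ^{n-r} is the i_r-th column of A with the coordinates indexed by i_1, …, i_r removed. -/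

import Mathlib

open Matrix
open scoped BigOperators

noncomputable section

/-- Euclidean norm of a finitely indexed real vector. -/
def euclNorm {ι : Type*} [Fintype ι] (x : ι → ℝ) : ℝ :=
  Real.sqrt (∑ i, (x i) ^ 2)

/-- The `k`-th largest eigenvalue (`1`-indexed) of a real square matrix, defined as the
`k`-th entry of the decreasingly sorted multiset of roots of the characteristic
polynomial.  For a real symmetric matrix this enumerates `λ_1(M) ≥ λ_2(M) ≥ …`. -/
def eigDesc {m : Type*} [Fintype m] [DecidableEq m] (M : Matrix m m ℝ) (k : ℕ) : ℝ :=
  ((M.charpoly.roots.sort (· ≤ ·)).reverse).getD (k - 1) 0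

/-- The minor of `A` obtained by deleting the rows and columns indexed by `S`. -/
def minorMatrix {n : ℕ} (A : Matrix (Fin n) (Fin n) ℝ) (S : Finset (Fin n)) :
    Matrix {x : Fin n // x ∉ S} {x : Fin n // x ∉ S} ℝ :=
  fun x y => A x.1 y.1

/-- `idxSet i r = {i_0, …, i_{r-1}}`: the first `r` of the deleted indices. -/
def idxSet {n j : ℕ} (i : Fin j → Fin n) (r : ℕ) : Finset (Fin n) :=
  Finset.image i (Finset.univ.filter fun s : Fin j => (s : ℕ) < r)

theorem aux_eigData {m : Type*} [Fintype m] [DecidableEq m] (M : Matrix m m ℝ)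
    (hM : M.IsHermitian) :
    ∃ (b : Fin (Fintype.card m) → m → ℝ) (lam : Fin (Fintype.card m) → ℝ),
      Antitone lam ∧ LinearIndependent ℝ b ∧
      (∀ i j, b i ⬝ᵥ b j = if i = j then 1 else 0) ∧
      (∀ i, M *ᵥ b i = lam i • b i) ∧
      (∀ k (hk : k < Fintype.card m), eigDesc M (k + 1) = lam ⟨k, hk⟩) := by
  have hT := isSymmetric_toEuclideanLin_iff.mpr hM
  let B := hT.eigenvectorBasis finrank_euclideanSpace
  have hB := hT.apply_eigenvectorBasis finrank_euclideanSpace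
  have hdot : ∀ i j, (B i : m → ℝ) ⬝ᵥ (B j : m → ℝ) = if i = j then 1 else 0 := by
    intro i j
    have := orthonormal_iff_ite.mp B.orthonormal i j
    rw [← this, dotProduct_comm]
    simp [PiLp.inner_apply, dotProduct]
  refine ⟨fun i => B i, hM.eigenvalues₀, hM.eigenvalues₀_antitone, ?_, hdot, ?_, ?_⟩
  · rw [Fintype.linearIndependent_iff]
    intro g hg i
    have h2 := congrArg (fun v => v ⬝ᵥ (B i : m → ℝ)) hg
    simpa [sum_dotProduct, smul_dotProduct, hdot] using h2
  · intro i
    have := congrArg (fun v : EuclideanSpace ℝ m => (v : m → ℝ)) (hB i)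
    simp only [toLpLin_apply] at this
    exact this
  · intro k hk
    have h1 := hM.sort_roots_charpoly_eq_eigenvalues₀
    have h2 : (M.charpoly.roots.sort (· ≤ ·)).reverse = List.ofFn hM.eigenvalues₀ := by
      rw [← h1]
      have h3 : M.charpoly.roots.map (RCLike.re : ℝ → ℝ) = M.charpoly.roots := by
        simp
      rw [h3]
      refine List.Perm.eq_of_pairwise (le := (· ≥ ·)) ?_ ?_ ?_ ?_
      · intro a b _ _ h h'
        exact le_antisymm h' h
      · rw [List.pairwise_reverse]
        exact Multiset.pairwise_sort _ _
      · exact Multiset.pairwise_sort _ _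
      · refine (List.reverse_perm _).trans ?_
        rw [← Multiset.coe_eq_coe, Multiset.sort_eq, Multiset.sort_eq]
    unfold eigDesc
    rw [h2]
    simp [hk]

theorem aux_span_form {m ι : Type*} [Fintype m] [Fintype ι] [DecidableEq ι]
    (M : Matrix m m ℝ) (b : ι → m → ℝ) (lam : ι → ℝ)
    (hdot : ∀ i j, b i ⬝ᵥ b j = if i = j then 1 else 0)
    (hb : ∀ i, M *ᵥ b i = lam i • b i) (v : m → ℝ)
    (hv : v ∈ Submodule.span ℝ (Set.range b)) :
    ∃ c : ι → ℝ, v ⬝ᵥ v = ∑ i, c i ^ 2 ∧ v ⬝ᵥ (M *ᵥ v) = ∑ i, lam i * c i ^ 2 := by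
  obtain ⟨c, rfl⟩ := (Submodule.mem_span_range_iff_exists_fun ℝ).mp hv
  refine ⟨c, ?_, ?_⟩
  · simp [sum_dotProduct, dotProduct_sum, hdot, pow_two]
  · simp only [mulVec_sum, mulVec_smul, hb, sum_dotProduct, dotProduct_sum, smul_dotProduct,
      dotProduct_smul, hdot]
    simp
    exact Finset.sum_congr rfl fun i _ => by ring

theorem aux_lower {m : Type*} [Fintype m] [DecidableEq m] (M : Matrix m m ℝ)
    (hM : M.IsHermitian) (k : ℕ) (hk : 1 ≤ k) (hkm : k ≤ Fintype.card m) :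
    ∃ V : Submodule ℝ (m → ℝ), Module.finrank ℝ V = k ∧
      ∀ v ∈ V, eigDesc M k * (v ⬝ᵥ v) ≤ v ⬝ᵥ (M *ᵥ v) := by
  obtain ⟨b, lam, hanti, hli, hdot, hb, he⟩ := aux_eigData M hM
  let f : Fin k → Fin (Fintype.card m) := Fin.castLE hkm
  have hf : Function.Injective f := Fin.castLE_injective hkm
  refine ⟨Submodule.span ℝ (Set.range (b ∘ f)), ?_, ?_⟩
  · rw [finrank_span_eq_card (hli.comp f hf)]; simp
  · intro v hv
    obtain ⟨c, h1, h2⟩ := aux_span_form M (b ∘ f) (lam ∘ f)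
      (fun i j => by simp [hdot, hf.eq_iff]) (fun i => hb _) v hv
    obtain ⟨k, rfl⟩ := Nat.exists_eq_add_of_le' hk
    rw [h1, h2, he k (by omega), Finset.mul_sum]
    refine Finset.sum_le_sum fun i _ => mul_le_mul_of_nonneg_right (hanti ?_) (sq_nonneg _)
    rw [Fin.le_def]
    have := i.2
    simp [f]; omega

theorem aux_upper {m : Type*} [Fintype m] [DecidableEq m] (M : Matrix m m ℝ)
    (hM : M.IsHermitian) (k : ℕ) (hk : 1 ≤ k) (hkm : k ≤ Fintype.card m) (c : ℝ)
    (V : Submodule ℝ (m → ℝ)) (hV : k ≤ Module.finrank ℝ V)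
    (h : ∀ v ∈ V, c * (v ⬝ᵥ v) ≤ v ⬝ᵥ (M *ᵥ v)) : c ≤ eigDesc M k := by
  obtain ⟨b, lam, hanti, hli, hdot, hb, he⟩ := aux_eigData M hM
  obtain ⟨k, rfl⟩ := Nat.exists_eq_add_of_le' hk
  let f : Fin (Fintype.card m - k) → Fin (Fintype.card m) := fun i => ⟨k + i, by omega⟩
  have hf : Function.Injective f := by
    intro x y hxy
    simp only [f, Fin.mk.injEq] at hxy
    exact Fin.ext (by omega)
  let W := Submodule.span ℝ (Set.range (b ∘ f))
  have hW : Module.finrank ℝ W = Fintype.card m - k := by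
    rw [finrank_span_eq_card (hli.comp f hf)]; simp
  have hd := Submodule.finrank_sup_add_finrank_inf_eq V W
  have hs := Submodule.finrank_le (V ⊔ W)
  rw [Module.finrank_fintype_fun_eq_card] at hs
  have hpos : 0 < Module.finrank ℝ (V ⊓ W : Submodule ℝ (m → ℝ)) := by omega
  have hne : V ⊓ W ≠ ⊥ := by
    intro h0
    rw [h0] at hpos
    simp at hpos
  obtain ⟨v, hv, hv0⟩ := Submodule.exists_mem_ne_zero_of_ne_bot hne
  obtain ⟨d, h1, h2⟩ := aux_span_form M (b ∘ f) (lam ∘ f)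
      (fun i j => by simp [hdot, hf.eq_iff]) (fun i => hb _) v hv.2
  have hvv : 0 < v ⬝ᵥ v := by
    refine lt_of_le_of_ne ?_ fun h => hv0 (dotProduct_self_eq_zero.mp h.symm)
    rw [h1]; positivity
  have h3 : v ⬝ᵥ (M *ᵥ v) ≤ eigDesc M (k + 1) * (v ⬝ᵥ v) := by
    rw [h1, h2, he k (by omega), Finset.mul_sum]
    refine Finset.sum_le_sum fun i _ => mul_le_mul_of_nonneg_right (hanti ?_) (sq_nonneg _)
    rw [Fin.le_def]
    simp [f]
  exact le_of_mul_le_mul_right ((h v hv.1).trans h3) hvv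

/-- Extension by zero. -/
def auxExt {m m' : Type*} (f : m → m') : (m → ℝ) →ₗ[ℝ] (m' → ℝ) :=
  Function.ExtendByZero.linearMap ℝ f

theorem auxExt_dot {m m' : Type*} [Fintype m] [Fintype m'] (f : m → m')
    (hf : Function.Injective f) (v : m → ℝ) (u : m' → ℝ) :
    auxExt f v ⬝ᵥ u = v ⬝ᵥ (u ∘ f) := by
  classical
  simp only [dotProduct, Function.comp]
  symm
  apply Finset.sum_of_injOn f hf.injOn
  · simp
  · intro x _ hx
    have : ¬ ∃ y, f y = x := by simpa using hx
    simp [auxExt, Function.extend_apply' _ _ _ this]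
  · intro x _
    simp [auxExt, hf.extend_apply]

theorem auxExt_comp {m m' : Type*} (f : m → m')
    (hf : Function.Injective f) (v : m → ℝ) : auxExt f v ∘ f = v := by
  funext x
  simp [auxExt, hf.extend_apply]

theorem auxExt_mulVec {m m' : Type*} [Fintype m] [Fintype m'] (f : m → m')
    (hf : Function.Injective f) (M : Matrix m' m' ℝ) (v : m → ℝ) :
    (M *ᵥ auxExt f v) ∘ f = M.submatrix f f *ᵥ v := by
  funext x
  simp only [Function.comp, mulVec]
  rw [dotProduct_comm, auxExt_dot f hf, dotProduct_comm]
  rfl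

theorem auxExt_inj {m m' : Type*} (f : m → m')
    (hf : Function.Injective f) : Function.Injective (auxExt f) := by
  intro v w h
  rw [← auxExt_comp f hf v, h, auxExt_comp f hf]

theorem aux_le {m m' : Type*} [Fintype m] [Fintype m'] [DecidableEq m] [DecidableEq m']
    (f : m → m') (hf : Function.Injective f) (M : Matrix m' m' ℝ) (hM : M.IsHermitian)
    (k : ℕ) (hk : 1 ≤ k) (hkm : k ≤ Fintype.card m) :
    eigDesc (M.submatrix f f) k ≤ eigDesc M k := by
  obtain ⟨V, hV, h⟩ := aux_lower (M.submatrix f f) (hM.submatrix f) k hk hkm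
  refine aux_upper M hM k hk (hkm.trans (Fintype.card_le_of_injective f hf)) _
    (V.map (auxExt f)) ?_ ?_
  · rw [(Submodule.equivMapOfInjective (auxExt f) (auxExt_inj f hf) _).symm.finrank_eq, hV]
  · rintro _ ⟨v, hv, rfl⟩
    rw [auxExt_dot f hf, auxExt_dot f hf, auxExt_comp f hf, auxExt_mulVec f hf]
    exact h v hv

theorem aux_ge {m m' : Type*} [Fintype m] [Fintype m'] [DecidableEq m] [DecidableEq m']
    (f : m → m') (hf : Function.Injective f) (M : Matrix m' m' ℝ) (hM : M.IsHermitian)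
    (k d : ℕ) (hk : 1 ≤ k) (hkm : k ≤ Fintype.card m)
    (hd : Fintype.card m' = Fintype.card m + d) :
    eigDesc M (k + d) ≤ eigDesc (M.submatrix f f) k := by
  obtain ⟨V, hV, h⟩ := aux_lower M hM (k + d) (by omega) (by omega)
  refine aux_upper _ (hM.submatrix f) k hk hkm _ (V.comap (auxExt f)) ?_ ?_
  · have h1 := Submodule.finrank_sup_add_finrank_inf_eq (LinearMap.range (auxExt f)) V
    have h2 := Submodule.finrank_le (LinearMap.range (auxExt f) ⊔ V)
    rw [Module.finrank_fintype_fun_eq_card] at h2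
    rw [LinearMap.finrank_range_of_inj (auxExt_inj f hf), Module.finrank_fintype_fun_eq_card,
      ← Submodule.map_comap_eq, (Submodule.equivMapOfInjective (auxExt f) (auxExt_inj f hf) _).symm.finrank_eq] at h1
    omega
  · intro v hv
    have := h _ hv
    rwa [auxExt_dot f hf, auxExt_dot f hf, auxExt_comp f hf, auxExt_mulVec f hf] at this

theorem aux_card {n : ℕ} (S : Finset (Fin n)) :
    Fintype.card {x : Fin n // x ∉ S} = n - S.card := by
  rw [Fintype.card_subtype_compl]
  simp

theorem aux_minor_mono {n : ℕ} (A : Matrix (Fin n) (Fin n) ℝ) (hA : A.IsHermitian)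
    (S T : Finset (Fin n)) (hST : S ⊆ T) (k : ℕ) (hk : 1 ≤ k) (hkT : k + T.card ≤ n) :
    eigDesc (minorMatrix A T) k ≤ eigDesc (minorMatrix A S) k := by
  let f : {x : Fin n // x ∉ T} → {x : Fin n // x ∉ S} := fun x => ⟨x.1, fun h => x.2 (hST h)⟩
  have hf : Function.Injective f := fun x y h => Subtype.ext (congrArg (fun z => z.1) h)
  exact aux_le f hf (minorMatrix A S) (hA.submatrix _) k hk (by rw [aux_card]; omega)

theorem aux_idx_card {n j : ℕ} (i : Fin j → Fin n) (r : ℕ) : (idxSet i r).card ≤ j := by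
  refine Finset.card_image_le.trans ((Finset.card_filter_le _ _).trans ?_)
  simp

theorem aux_idx_mono {n j : ℕ} (i : Fin j → Fin n) {r s : ℕ} (h : r ≤ s) :
    idxSet i r ⊆ idxSet i s := by
  refine Finset.image_subset_image fun x hx => ?_
  simp only [Finset.mem_filter, Finset.mem_univ, true_and] at hx ⊢
  omega

theorem aux_exists {n : ℕ} (A : Matrix (Fin n) (Fin n) ℝ) (hA : A.IsHermitian)
    (S : Finset (Fin n)) (k : ℕ) (hk : 1 ≤ k) (hkS : k + S.card ≤ n) :
    ∃ w : Fin n → ℝ, (∀ x ∈ S, w x = 0) ∧ w ⬝ᵥ w = 1 ∧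
      ∀ x, x ∉ S → (A *ᵥ w) x = eigDesc (minorMatrix A S) k * w x := by
  obtain ⟨b, lam, -, -, hdot, hb, he⟩ := aux_eigData (minorMatrix A S) (hA.submatrix _)
  obtain ⟨k, rfl⟩ := Nat.exists_eq_add_of_le' hk
  have hk' : k < Fintype.card {x : Fin n // x ∉ S} := by rw [aux_card]; omega
  let f : {x : Fin n // x ∉ S} → Fin n := Subtype.val
  have hf : Function.Injective f := Subtype.val_injective
  have hc := auxExt_comp f hf (b ⟨k, hk'⟩)
  refine ⟨auxExt f (b ⟨k, hk'⟩), ?_, ?_, ?_⟩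
  · intro x hx
    have : ¬ ∃ y, f y = x := by
      rintro ⟨y, rfl⟩
      exact y.2 hx
    simp [auxExt, Function.extend_apply' _ _ _ this]
  · rw [auxExt_dot f hf, hc, hdot]; simp
  · intro x hx
    have h1 := congrFun (auxExt_mulVec f hf A (b ⟨k, hk'⟩)) ⟨x, hx⟩
    have h2 := congrFun hc ⟨x, hx⟩
    have h3 := congrFun (hb ⟨k, hk'⟩) ⟨x, hx⟩
    simp only [Function.comp, Pi.smul_apply, smul_eq_mul] at h1 h2 h3
    rw [he k hk']
    refine h1.trans (h3.trans ?_)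
    rw [← h2]

theorem aux_step {n : ℕ} (A : Matrix (Fin n) (Fin n) ℝ) (hA : A.IsSymm)
    (S : Finset (Fin n)) (s : Fin n) (hs : s ∉ S) (u w : Fin n → ℝ) (α β : ℝ)
    (hu0 : ∀ x ∈ S, u x = 0) (hw0 : ∀ x ∈ insert s S, w x = 0)
    (hu1 : u ⬝ᵥ u = 1) (hw1 : w ⬝ᵥ w = 1)
    (hu : ∀ x, x ∉ S → (A *ᵥ u) x = α * u x)
    (hw : ∀ x, x ∉ insert s S → (A *ᵥ w) x = β * w x) :
    |u s| * |∑ x, w x * A x s| ≤ |α - β| := by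
  have e1 : w ⬝ᵥ (A *ᵥ u) = α * (u ⬝ᵥ w) := by
    simp only [dotProduct, Finset.mul_sum]
    refine Finset.sum_congr rfl fun x _ => ?_
    by_cases hx : x ∈ S
    · simp [hw0 x (Finset.mem_insert_of_mem hx)]
    · rw [hu x hx]; ring
  have hsum : (A *ᵥ w) s = ∑ x, w x * A x s := by
    simp only [mulVec, dotProduct]
    refine Finset.sum_congr rfl fun x _ => ?_
    rw [hA.apply, mul_comm]
  have e2 : u ⬝ᵥ (A *ᵥ w) = β * (u ⬝ᵥ w) + u s * (A *ᵥ w) s := by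
    have : ∀ x, u x * (A *ᵥ w) x = β * (u x * w x) + if x = s then u s * (A *ᵥ w) s else 0 := by
      intro x
      by_cases hxs : x = s
      · subst hxs
        simp [hw0 x (Finset.mem_insert_self _ _)]
      · by_cases hx : x ∈ S
        · simp [hu0 x hx, hxs]
        · rw [hw x (by simp [hxs, hx])]; simp [hxs]; ring
    unfold dotProduct
    rw [Finset.sum_congr rfl fun x _ => this x, Finset.sum_add_distrib, ← Finset.mul_sum,
      Finset.sum_ite_eq' Finset.univ s]
    simp
  have e3 : w ⬝ᵥ (A *ᵥ u) = u ⬝ᵥ (A *ᵥ w) := by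
    rw [dotProduct_mulVec, ← mulVec_transpose, hA.eq, dotProduct_comm]
  have e4 : u s * (A *ᵥ w) s = (α - β) * (u ⬝ᵥ w) := by
    rw [e1, e2] at e3
    linarith
  have cs : |u ⬝ᵥ w| ≤ 1 := by
    have p : 0 ≤ (u + w) ⬝ᵥ (u + w) := Finset.sum_nonneg fun x _ => mul_self_nonneg _
    have q : 0 ≤ (u - w) ⬝ᵥ (u - w) := Finset.sum_nonneg fun x _ => mul_self_nonneg _
    simp only [add_dotProduct, dotProduct_add, sub_dotProduct, dotProduct_sub, hu1, hw1] at p q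
    rw [dotProduct_comm w u] at p q
    rw [abs_le]
    constructor <;> linarith
  rw [← hsum, ← abs_mul, e4, abs_mul]
  exact mul_le_of_le_one_right (abs_nonneg _) cs

/-- **Fact (iterated interlacing).**
Let `A` be an `n × n` real symmetric matrix with `1 ≤ k`, `k + j < n` and
`|λ_{k+j}(A) − λ_k(A)| ≤ ε n^{-1/2}`, and let `i_1, …, i_j ∈ [n]` be distinct (here
encoded as an injective `i : Fin j → Fin n`).  Then there are unit vectors
`w^{(0)}, …, w^{(j)}`, where `w^{(r)}` is supported off `{i_1,…,i_r}` and is (as a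
vector on the complementary coordinates) a unit eigenvector of the minor
`A^{(i_1,…,i_r)}` with eigenvalue `λ_k(A^{(i_1,…,i_r)})`, such that for each `r ∈ [j]`:
`|w^{(r-1)}_{i_r}| · |⟨w^{(r)}, X_r⟩| ≤ ε n^{-1/2}`, where
`X_r` is the `i_r`-th column of `A` with the coordinates `i_1, …, i_r` removed
(the inner product being encoded by the full sum, since `w^{(r)}` vanishes on
`{i_1,…,i_r}`). -/
theorem iterated_interlacing
    (n k j : ℕ) (hk : 1 ≤ k) (hkj : k + j < n) (ε : ℝ) (hε : 0 ≤ ε)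
    (A : Matrix (Fin n) (Fin n) ℝ) (hA : A.IsSymm)
    (hgap : |eigDesc A (k + j) - eigDesc A k| ≤ ε / Real.sqrt n)
    (i : Fin j → Fin n) (hi : Function.Injective i) :
    ∃ w : Fin (j + 1) → Fin n → ℝ,
      (∀ r : Fin (j + 1),
        (∀ x ∈ idxSet i (r : ℕ), w r x = 0) ∧
        euclNorm (w r) = 1 ∧
        (∀ x : Fin n, x ∉ idxSet i (r : ℕ) →
          A.mulVec (w r) x = eigDesc (minorMatrix A (idxSet i (r : ℕ))) k * w r x)) ∧
      (∀ r : Fin j,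
        |w r.castSucc (i r)| * |∑ x, w r.succ x * A x (i r)| ≤ ε / Real.sqrt n) := by
  have hH : A.IsHermitian := by
    rw [Matrix.IsHermitian, conjTranspose_eq_transpose_of_trivial]
    exact hA
  have hcard : ∀ r, k + (idxSet i r).card ≤ n := fun r => by
    have := aux_idx_card i r
    omega
  choose w h0 h1 h2 using fun r : Fin (j + 1) =>
    aux_exists A hH (idxSet i (r : ℕ)) k hk (hcard r)
  refine ⟨w, fun r => ⟨h0 r, ?_, h2 r⟩, fun r => ?_⟩
  · have := h1 r
    simp only [dotProduct, ← pow_two] at this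
    rw [euclNorm, this, Real.sqrt_one]
  · have hins : idxSet i ((r.succ : Fin (j + 1)) : ℕ) =
        insert (i r) (idxSet i ((r.castSucc : Fin (j + 1)) : ℕ)) := by
      ext x
      simp only [idxSet, Finset.mem_image, Finset.mem_filter, Finset.mem_univ, true_and,
        Finset.mem_insert, Fin.val_succ, Fin.val_castSucc]
      constructor
      · rintro ⟨a, ha, rfl⟩
        rcases Nat.lt_succ_iff_lt_or_eq.mp ha with h | h
        · exact Or.inr ⟨a, h, rfl⟩
        · exact Or.inl (congrArg i (Fin.ext h))
      · rintro (rfl | ⟨a, ha, rfl⟩)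
        · exact ⟨r, by omega, rfl⟩
        · exact ⟨a, by omega, rfl⟩
    have hnot : i r ∉ idxSet i ((r.castSucc : Fin (j + 1)) : ℕ) := by
      simp only [idxSet, Finset.mem_image, Finset.mem_filter, Finset.mem_univ, true_and,
        Fin.val_castSucc, not_exists, not_and]
      intro a ha hEq
      rw [hi hEq] at ha
      omega
    refine (aux_step A hA _ (i r) hnot (w r.castSucc) (w r.succ) _ _ (h0 _)
      (hins ▸ h0 r.succ) (h1 _) (h1 _) (h2 _) (hins ▸ h2 r.succ)).trans (le_trans ?_ hgap)
    rw [← hins]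
    have hjc : (idxSet i j).card = j := by
      rw [idxSet, Finset.card_image_of_injective _ hi, Finset.filter_true_of_mem (fun x _ => x.2)]
      simp
    have a1 := aux_minor_mono A hH _ _ (aux_idx_mono i (Nat.le_succ (r : ℕ))) k hk (hcard _)
    have a2 := aux_minor_mono A hH _ _ (aux_idx_mono i (show (r : ℕ) + 1 ≤ j from r.2)) k hk
      (hcard _)
    have a3 : eigDesc (minorMatrix A (idxSet i (r : ℕ))) k ≤ eigDesc A k :=
      aux_le Subtype.val Subtype.val_injective A hH k hk
        (by rw [aux_card]; have := hcard r; omega)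
    have a4 : eigDesc A (k + j) ≤ eigDesc (minorMatrix A (idxSet i j)) k :=
      aux_ge Subtype.val Subtype.val_injective A hH k j hk
        (by rw [aux_card]; have := hcard j; omega)
        (by rw [aux_card, hjc, Fintype.card_fin]; omega)
    simp only [Fin.val_succ, Fin.val_castSucc]
    simp only [Nat.succ_eq_add_one] at a1
    rw [abs_of_nonneg (by linarith), abs_of_nonpos (by linarith)]
    linarith
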